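/- arXiv:1612.07616 — 2 statements merged into one kernel-verified Lean document; each statement's English description precedes it below -/
import Mathlib

section
/- Let {P_i}_{i=1}^k be orthogonal diagonal projections on ℂ^n with Σ P_i = I_n, and {Q_j}_{j=1}^l orthogonal diagonal projections on ℂ^m with Σ Q_j = I_m, where 1 ≤ k,l ≤ min(n,m), and all P_i, Q_j nonzero. Let S^n_a denote the cyclic shift by a on ℂ^n. Then V_1 = Σ_{i=1}^k P_i ⊗ S^m_i and V_2 = Σ_{j=1}^l S^n_j ⊗ Q_j are unitary, and U = V_1 V_2 = Σ_{i,j} P_i S^n_j ⊗ S^m_i Q_j has operator Schmidt rank Ω(U) = kl. -/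
open Matrix Kronecker

/-- The realignment (reshuffling) of a bipartite operator. -/
def realign {n m : ℕ} (X : Matrix (Fin n × Fin m) (Fin n × Fin m) ℂ) :
    Matrix (Fin n × Fin n) (Fin m × Fin m) ℂ :=
  Matrix.of fun p q => X (p.1, q.1) (p.2, q.2)

/-- The operator Schmidt rank of a bipartite operator, i.e. the rank
of its realignment. -/
noncomputable def osr {n m : ℕ} (X : Matrix (Fin n × Fin m) (Fin n × Fin m) ℂ) : ℕ :=
  (realign X).rank

/-- The cyclic shift by `a` on `ℂ^n`: `S^n_a e_i = e_{i+a mod n}`. -/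
def shiftM (n : ℕ) (a : ℕ) : Matrix (Fin n) (Fin n) ℂ :=
  Matrix.of fun i j => if (i : ZMod n) = (j : ZMod n) + (a : ZMod n) then 1 else 0

theorem Fin.cast_zmod_inj {n : ℕ} {a b : Fin n} : (a : ZMod n) = (b : ZMod n) ↔ a = b := by
  refine ⟨fun h => ?_, fun h => h ▸ rfl⟩
  rw [ZMod.natCast_eq_natCast_iff', Nat.mod_eq_of_lt a.2, Nat.mod_eq_of_lt b.2] at h
  exact Fin.ext h

theorem Fin.exists_cast_zmod_eq {n : ℕ} (hn : 0 < n) (x : ZMod n) :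
    ∃ b : Fin n, (b : ZMod n) = x := by
  have : NeZero n := ⟨hn.ne'⟩
  exact ⟨⟨x.val, x.val_lt⟩, ZMod.natCast_zmod_val x⟩

theorem cast_val_succ_zmod_inj {n k : ℕ} (hk : k ≤ n) {i j : Fin k} :
    ((i.val + 1 : ℕ) : ZMod n) = ((j.val + 1 : ℕ) : ZMod n) ↔ i = j := by
  have h := @Fin.cast_zmod_inj n (Fin.castLE hk i) (Fin.castLE hk j)
  simpa using h

theorem shiftM_mul_conjTranspose (n a : ℕ) : shiftM n a * (shiftM n a)ᴴ = 1 := by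
  ext i j
  obtain ⟨c, hc⟩ := Fin.exists_cast_zmod_eq i.pos ((i : ZMod n) - (a : ZMod n))
  rw [Matrix.mul_apply, Finset.sum_eq_single c]
  · simp [shiftM, hc, Matrix.one_apply, Fin.cast_zmod_inj, eq_comm]
  · intro b _ hb
    have : ¬ (i : ZMod n) = (b : ZMod n) + (a : ZMod n) := fun h =>
      hb (Fin.cast_zmod_inj.1 (by rw [hc, h, add_sub_cancel_right]))
    simp [shiftM, this]
  · simp

namespace Matrix.IsDiag

variable {ι : Type*} [Fintype ι] [DecidableEq ι] {A : Matrix ι ι ℂ}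

theorem mul_apply_left (hA : A.IsDiag) (B : Matrix ι ι ℂ) (a b : ι) :
    (A * B) a b = A a a * B a b := by
  conv_lhs => rw [← hA.diagonal_diag]
  simp [Matrix.diagonal_mul]

theorem mul_apply_right (hA : A.IsDiag) (B : Matrix ι ι ℂ) (a b : ι) :
    (B * A) a b = B a b * A b b := by
  conv_lhs => rw [← hA.diagonal_diag]
  simp [Matrix.mul_diagonal]

theorem apply_self_eq_zero_or_one (hA : A.IsDiag) (hp : A * A = A) (a : ι) :
    A a a = 0 ∨ A a a = 1 := by
  have h := congrFun (congrFun hp a) a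
  rw [hA.mul_apply_left] at h
  exact IsIdempotentElem.iff_eq_zero_or_one.1 h

theorem conjTranspose_eq_of_mul_self (hA : A.IsDiag) (hp : A * A = A) : Aᴴ = A := by
  ext a b
  rw [Matrix.conjTranspose_apply]
  by_cases hab : a = b
  · subst hab
    rcases hA.apply_self_eq_zero_or_one hp a with h | h <;> simp [h]
  · rw [hA hab, hA (Ne.symm hab), star_zero]

theorem exists_apply_self_eq_one (hA : A.IsDiag) (hp : A * A = A) (hnz : A ≠ 0) :
    ∃ a, A a a = 1 := by
  by_contra! h
  refine hnz (Matrix.ext fun a b => ?_)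
  by_cases hab : a = b
  · subst hab
    exact (hA.apply_self_eq_zero_or_one hp a).resolve_right (h a)
  · exact hA hab

/-- Orthogonal nonzero diagonal projections have pairwise distinguishing diagonal positions. -/
theorem exists_apply_self_eq_ite {κ : Type*} [DecidableEq κ] {P : κ → Matrix ι ι ℂ}
    (hd : ∀ i, (P i).IsDiag) (hp : ∀ i, P i * P i = P i) (ho : ∀ i j, i ≠ j → P i * P j = 0)
    (hnz : ∀ i, P i ≠ 0) : ∃ a : κ → ι, ∀ i j, P j (a i) (a i) = if i = j then 1 else 0 := by
  choose a ha using fun i => (hd i).exists_apply_self_eq_one (hp i) (hnz i)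
  refine ⟨a, fun i j => ?_⟩
  split_ifs with hij
  · rw [← hij, ha]
  · have h := congrFun (congrFun (ho i j hij) (a i)) (a i)
    rwa [(hd i).mul_apply_left, ha, one_mul] at h

end Matrix.IsDiag

/-- A controlled unitary, with control given by an orthogonal resolution of the identity on the
first factor, is unitary. -/
theorem sum_kronecker_mem_unitaryGroup {ι α β : Type*} [Fintype ι] [Fintype α] [DecidableEq α]
    [Fintype β] [DecidableEq β] {P : ι → Matrix α α ℂ} {V : ι → Matrix β β ℂ}
    (hs : ∀ i, (P i)ᴴ = P i) (hp : ∀ i, P i * P i = P i) (ho : ∀ i j, i ≠ j → P i * P j = 0)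
    (h1 : ∑ i, P i = 1) (hV : ∀ i, V i * (V i)ᴴ = 1) :
    (∑ i, P i ⊗ₖ V i) ∈ Matrix.unitaryGroup (α × β) ℂ := by
  rw [Matrix.mem_unitaryGroup_iff, Matrix.star_eq_conjTranspose, Matrix.conjTranspose_sum,
    Finset.sum_mul_sum]
  have h : ∀ i, ∑ j, (P i ⊗ₖ V i) * (P j ⊗ₖ V j)ᴴ = P i ⊗ₖ (1 : Matrix β β ℂ) := fun i => by
    rw [Finset.sum_eq_single i]
    · rw [Matrix.conjTranspose_kronecker, ← Matrix.mul_kronecker_mul, hs, hp, hV]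
    · intro j _ hj
      rw [Matrix.conjTranspose_kronecker, ← Matrix.mul_kronecker_mul, hs, ho i j hj.symm,
        Matrix.zero_kronecker]
    · simp
  simp_rw [h]
  rw [← Matrix.one_kronecker_one, ← h1]
  ext ⟨a, b⟩ ⟨c, d⟩
  simp [Matrix.sum_apply, Finset.sum_mul]

/-- A controlled unitary, with control given by an orthogonal resolution of the identity on the
second factor, is unitary. -/
theorem sum_kronecker_mem_unitaryGroup' {ι α β : Type*} [Fintype ι] [Fintype α] [DecidableEq α]
    [Fintype β] [DecidableEq β] {P : ι → Matrix α α ℂ} {V : ι → Matrix β β ℂ}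
    (hs : ∀ i, (P i)ᴴ = P i) (hp : ∀ i, P i * P i = P i) (ho : ∀ i j, i ≠ j → P i * P j = 0)
    (h1 : ∑ i, P i = 1) (hV : ∀ i, V i * (V i)ᴴ = 1) :
    (∑ i, V i ⊗ₖ P i) ∈ Matrix.unitaryGroup (β × α) ℂ := by
  rw [Matrix.mem_unitaryGroup_iff, Matrix.star_eq_conjTranspose, Matrix.conjTranspose_sum,
    Finset.sum_mul_sum]
  have h : ∀ i, ∑ j, (V i ⊗ₖ P i) * (V j ⊗ₖ P j)ᴴ = (1 : Matrix β β ℂ) ⊗ₖ P i := fun i => by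
    rw [Finset.sum_eq_single i]
    · rw [Matrix.conjTranspose_kronecker, ← Matrix.mul_kronecker_mul, hs, hp, hV]
    · intro j _ hj
      rw [Matrix.conjTranspose_kronecker, ← Matrix.mul_kronecker_mul, hs, ho i j hj.symm,
        Matrix.kronecker_zero]
    · simp
  simp_rw [h]
  rw [← Matrix.one_kronecker_one, ← h1]
  ext ⟨a, b⟩ ⟨c, d⟩
  simp [Matrix.sum_apply, Finset.mul_sum]

/-- A sum of tensor products whose factors admit dual families of matrix entries has operator
Schmidt rank equal to the number of terms. -/
theorem osr_sum_kronecker {ι : Type*} [Fintype ι] [DecidableEq ι] {n m : ℕ}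
    {A : ι → Matrix (Fin n) (Fin n) ℂ} {B : ι → Matrix (Fin m) (Fin m) ℂ}
    {f : ι → Fin n × Fin n} {g : ι → Fin m × Fin m}
    (hf : ∀ x y, A y (f x).1 (f x).2 = if x = y then 1 else 0)
    (hg : ∀ x y, B y (g x).1 (g x).2 = if x = y then 1 else 0) :
    osr (∑ x, A x ⊗ₖ B x) = Fintype.card ι := by
  let L : Matrix (Fin n × Fin n) ι ℂ := Matrix.of fun p x => A x p.1 p.2
  let R : Matrix ι (Fin m × Fin m) ℂ := Matrix.of fun x q => B x q.1 q.2
  have hLR : realign (∑ x, A x ⊗ₖ B x) = L * R := by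
    ext p q
    simp [realign, L, R, Matrix.mul_apply, Matrix.sum_apply]
  have hsub : (L * R).submatrix f g = 1 := by
    have hL : L.submatrix f id = 1 := by
      ext x y
      simp [L, hf, Matrix.one_apply]
    have hR : R.submatrix id g = 1 := by
      ext x y
      simp [R, hg, Matrix.one_apply, eq_comm]
    rw [Matrix.submatrix_mul L R f id g Function.bijective_id, hL, hR, one_mul]
  rw [osr, hLR]
  apply le_antisymm
  · exact (Matrix.rank_mul_le_left L R).trans (Matrix.rank_le_card_width L)
  · calc Fintype.card ι = ((L * R).submatrix f g).rank := by rw [hsub, Matrix.rank_one]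
      _ ≤ (L * R).rank := Matrix.rank_submatrix_le _ _ _

theorem exists_diag_mul_shiftM_apply_eq_ite {n k l : ℕ} (hl : l ≤ n)
    {P : Fin k → Matrix (Fin n) (Fin n) ℂ}
    (hd : ∀ i, (P i).IsDiag) (hp : ∀ i, P i * P i = P i) (ho : ∀ i j, i ≠ j → P i * P j = 0)
    (hnz : ∀ i, P i ≠ 0) :
    ∃ f : Fin k × Fin l → Fin n × Fin n, ∀ x y,
      (P y.1 * shiftM n (y.2.val + 1)) (f x).1 (f x).2 = if x = y then 1 else 0 := by
  obtain ⟨a, ha⟩ := Matrix.IsDiag.exists_apply_self_eq_ite hd hp ho hnz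
  choose b hb using fun x : Fin k × Fin l => Fin.exists_cast_zmod_eq (a x.1).pos
    ((a x.1 : ZMod n) - ((x.2.val + 1 : ℕ) : ZMod n))
  refine ⟨fun x => (a x.1, b x), fun x y => ?_⟩
  have h : (a x.1 : ZMod n) = (b x : ZMod n) + ((y.2.val + 1 : ℕ) : ZMod n) ↔ x.2 = y.2 := by
    rw [hb, ← cast_val_succ_zmod_inj hl, sub_add_eq_add_sub, eq_sub_iff_add_eq, add_right_inj]
  rw [(hd y.1).mul_apply_left, ha, shiftM, Matrix.of_apply]
  simp only [h, Prod.ext_iff, ← ite_and, mul_ite, mul_one, mul_zero, and_comm]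

theorem exists_shiftM_mul_diag_apply_eq_ite {m k l : ℕ} (hk : k ≤ m)
    {Q : Fin l → Matrix (Fin m) (Fin m) ℂ}
    (hd : ∀ i, (Q i).IsDiag) (hp : ∀ i, Q i * Q i = Q i) (ho : ∀ i j, i ≠ j → Q i * Q j = 0)
    (hnz : ∀ i, Q i ≠ 0) :
    ∃ g : Fin k × Fin l → Fin m × Fin m, ∀ x y,
      (shiftM m (y.1.val + 1) * Q y.2) (g x).1 (g x).2 = if x = y then 1 else 0 := by
  obtain ⟨d, hd'⟩ := Matrix.IsDiag.exists_apply_self_eq_ite hd hp ho hnz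
  choose c hc using fun x : Fin k × Fin l => Fin.exists_cast_zmod_eq (d x.2).pos
    ((d x.2 : ZMod m) + ((x.1.val + 1 : ℕ) : ZMod m))
  refine ⟨fun x => (c x, d x.2), fun x y => ?_⟩
  have h : (c x : ZMod m) = (d x.2 : ZMod m) + ((y.1.val + 1 : ℕ) : ZMod m) ↔ x.1 = y.1 := by
    rw [hc, ← cast_val_succ_zmod_inj hk, add_right_inj]
  rw [(hd y.2).mul_apply_right, hd', shiftM, Matrix.of_apply]
  simp only [h, Prod.ext_iff, ← ite_and, mul_ite, mul_one, mul_zero, and_comm]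

/-- Given complete families of nonzero pairwise-orthogonal diagonal projections
`{P_i}` on `ℂ^n` and `{Q_j}` on `ℂ^m`, the operators
`V_1 = Σ P_i ⊗ S^m_i` and `V_2 = Σ S^n_j ⊗ Q_j` are unitary and
`U = V_1 V_2` has operator Schmidt rank `k·l`. -/
theorem stmt11 {n m k l : ℕ} (hk : 1 ≤ k) (hk' : k ≤ min n m)
    (hl : 1 ≤ l) (hl' : l ≤ min n m)
    (P : Fin k → Matrix (Fin n) (Fin n) ℂ) (Q : Fin l → Matrix (Fin m) (Fin m) ℂ)
    (hPd : ∀ i, (P i).IsDiag) (hQd : ∀ j, (Q j).IsDiag)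
    (hPp : ∀ i, P i * P i = P i) (hQp : ∀ j, Q j * Q j = Q j)
    (hPo : ∀ i i', i ≠ i' → P i * P i' = 0) (hQo : ∀ j j', j ≠ j' → Q j * Q j' = 0)
    (hP1 : ∑ i, P i = 1) (hQ1 : ∑ j, Q j = 1)
    (hPnz : ∀ i, P i ≠ 0) (hQnz : ∀ j, Q j ≠ 0) :
    (∑ i, P i ⊗ₖ shiftM m (i.val + 1)) ∈ Matrix.unitaryGroup (Fin n × Fin m) ℂ ∧
    (∑ j, shiftM n (j.val + 1) ⊗ₖ Q j) ∈ Matrix.unitaryGroup (Fin n × Fin m) ℂ ∧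
    osr ((∑ i, P i ⊗ₖ shiftM m (i.val + 1)) * (∑ j, shiftM n (j.val + 1) ⊗ₖ Q j))
      = k * l := by
  refine ⟨sum_kronecker_mem_unitaryGroup
      (fun i => (hPd i).conjTranspose_eq_of_mul_self (hPp i)) hPp hPo hP1
      fun _ => shiftM_mul_conjTranspose _ _,
    sum_kronecker_mem_unitaryGroup'
      (fun j => (hQd j).conjTranspose_eq_of_mul_self (hQp j)) hQp hQo hQ1
      fun _ => shiftM_mul_conjTranspose _ _, ?_⟩
  obtain ⟨f, hf⟩ := exists_diag_mul_shiftM_apply_eq_ite (hl'.trans (min_le_left n m))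
    hPd hPp hPo hPnz
  obtain ⟨g, hg⟩ := exists_shiftM_mul_diag_apply_eq_ite (hk'.trans (min_le_right n m))
    hQd hQp hQo hQnz
  have h := osr_sum_kronecker hf hg
  rw [Fintype.card_prod, Fintype.card_fin, Fintype.card_fin] at h
  rw [← h, Finset.sum_mul_sum, Fintype.sum_prod_type]
  simp_rw [Matrix.mul_kronecker_mul]
end

section
/- For any n, m with (n,m) ≠ (2,2) and any r ∈ {1, ..., min(n,m)²}, there exists a unitary U ∈ U(ℂ^n ⊗ ℂ^m) with operator Schmidt rank Ω(U) = r. -/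
open Matrix Kronecker

theorem submatrix_equiv_mem_unitaryGroup {ι κ : Type*} [Fintype ι] [Fintype κ] [DecidableEq ι]
    [DecidableEq κ] {U : Matrix ι ι ℂ} (hU : U ∈ Matrix.unitaryGroup ι ℂ) (e : κ ≃ ι) :
    U.submatrix e e ∈ Matrix.unitaryGroup κ ℂ := by
  rw [Matrix.mem_unitaryGroup_iff, Matrix.star_eq_conjTranspose] at hU ⊢
  rw [Matrix.conjTranspose_submatrix, Matrix.submatrix_mul_equiv, hU, Matrix.submatrix_one_equiv]

theorem fromBlocks_mem_unitaryGroup {ι κ : Type*} [Fintype ι] [Fintype κ] [DecidableEq ι]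
    [DecidableEq κ] {U : Matrix ι ι ℂ} {V : Matrix κ κ ℂ}
    (hU : U ∈ Matrix.unitaryGroup ι ℂ) (hV : V ∈ Matrix.unitaryGroup κ ℂ) :
    Matrix.fromBlocks U 0 0 V ∈ Matrix.unitaryGroup (ι ⊕ κ) ℂ := by
  rw [Matrix.mem_unitaryGroup_iff, Matrix.star_eq_conjTranspose] at hU hV ⊢
  simp [Matrix.fromBlocks_conjTranspose, Matrix.fromBlocks_multiply, hU, hV]

theorem permMatrix_mem_unitaryGroup {ι : Type*} [Fintype ι] [DecidableEq ι] (σ : Equiv.Perm ι) :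
    σ.permMatrix ℂ ∈ Matrix.unitaryGroup ι ℂ := by
  rw [Matrix.mem_unitaryGroup_iff, Matrix.star_eq_conjTranspose, Matrix.conjTranspose_permMatrix,
    ← Matrix.permMatrix_mul, inv_mul_cancel, Matrix.permMatrix_one]

theorem exists_unitary_not_mem {α : Type*} [Fintype α] [DecidableEq α]
    {V : Submodule ℂ (Matrix α α ℂ)} (hV : V ≠ ⊤) :
    ∃ W ∈ Matrix.unitaryGroup α ℂ, W ∉ V := by
  open scoped Matrix.Norms.L2Operator in
  by_contra! h
  exact hV (top_le_iff.1 (CStarAlgebra.span_unitary (A := Matrix α α ℂ) ▸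
    Submodule.span_le.2 h))

theorem finrank_submodule_prod {K E F : Type*} [DivisionRing K] [AddCommGroup E] [AddCommGroup F]
    [Module K E] [Module K F] (p : Submodule K E) (q : Submodule K F) [FiniteDimensional K p]
    [FiniteDimensional K q] :
    Module.finrank K (p.prod q) = Module.finrank K p + Module.finrank K q := by
  have h := LinearMap.finrank_range_of_inj (f := p.subtype.prodMap q.subtype)
    (p.injective_subtype.prodMap q.injective_subtype)
  rwa [LinearMap.range_prodMap, p.range_subtype, q.range_subtype, Module.finrank_prod] at h

theorem rank_fromBlocks_zero_zero {ι κ ι' κ' : Type*} [Fintype ι] [Fintype κ] [Finite ι']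
    [Finite κ'] (A : Matrix ι' ι ℂ) (B : Matrix κ' κ ℂ) :
    (Matrix.fromBlocks A 0 0 B).rank = A.rank + B.rank := by
  have h : (Matrix.fromBlocks A 0 0 B).mulVecLin =
      (LinearEquiv.sumArrowLequivProdArrow ι' κ' ℂ ℂ).symm.toLinearMap ∘ₗ
        (A.mulVecLin.prodMap B.mulVecLin) ∘ₗ
          (LinearEquiv.sumArrowLequivProdArrow ι κ ℂ ℂ).toLinearMap := by
    refine LinearMap.ext fun v => funext fun i => ?_
    rcases i with i | i <;>
      simp [Matrix.mulVec, dotProduct, LinearEquiv.sumArrowLequivProdArrow,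
        Equiv.sumArrowEquivProdArrow]
  rw [Matrix.rank, h, LinearMap.range_comp, LinearMap.range_comp_of_range_eq_top _
    (LinearEquiv.range _), LinearEquiv.finrank_map_eq, LinearMap.range_prodMap,
    finrank_submodule_prod]
  rfl

/-- The realignment of an operator on a tensor product indexed by arbitrary types. -/
def reshuffle {α β : Type} (X : Matrix (α × β) (α × β) ℂ) : Matrix (α × α) (β × β) ℂ :=
  Matrix.of fun p q => X (p.1, q.1) (p.2, q.2)

/-- Splits off the last level of the second tensor factor. -/
def prodOptionEquivSum (α β : Type) : α × Option β ≃ (α × β) ⊕ α where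
  toFun
    | (a, some b) => .inl (a, b)
    | (a, none) => .inr a
  invFun
    | .inl (a, b) => (a, some b)
    | .inr a => (a, none)
  left_inv := by rintro ⟨a, _ | b⟩ <;> rfl
  right_inv := by rintro (⟨a, b⟩ | a) <;> rfl

/-- The block-diagonal extension of `U` by `W` on the new level of the second factor. -/
def extendRight {α β : Type} (U : Matrix (α × β) (α × β) ℂ) (W : Matrix α α ℂ) :
    Matrix (α × Option β) (α × Option β) ℂ :=
  (Matrix.fromBlocks U 0 0 W).submatrix (prodOptionEquivSum α β) (prodOptionEquivSum α β)

theorem rank_reshuffle_extendRight {α β : Type} [Finite α] [Fintype β]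
    (U : Matrix (α × β) (α × β) ℂ) (W : Matrix α α ℂ) :
    (reshuffle (extendRight U W)).rank =
      Module.finrank ℂ ↥(Submodule.span ℂ (Set.range (reshuffle U).col) ⊔
        Submodule.span ℂ {Function.uncurry W}) := by
  rw [Matrix.rank_eq_finrank_span_cols]
  refine congrArg (fun V : Submodule ℂ (α × α → ℂ) => Module.finrank ℂ V) ?_
  refine le_antisymm (Submodule.span_le.2 ?_) (sup_le (Submodule.span_le.2 ?_) ?_)
  · rintro _ ⟨⟨_ | b, _ | b'⟩, rfl⟩
    · exact Submodule.mem_sup_right (Submodule.mem_span_singleton_self _)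
    · convert! Submodule.zero_mem _
    · convert! Submodule.zero_mem _
    · exact Submodule.mem_sup_left (Submodule.subset_span ⟨(b, b'), rfl⟩)
  · rintro _ ⟨⟨b, b'⟩, rfl⟩
    exact Submodule.subset_span ⟨(some b, some b'), rfl⟩
  · rw [Submodule.span_singleton_le_iff_mem]
    exact Submodule.subset_span ⟨(none, none), rfl⟩

/-- Splits off the pairs involving the last level of either tensor factor. -/
def optionProdOptionEquivSum (α : Type) : Option α × Option α ≃ (α × α) ⊕ (α ⊕ Option α) where
  toFun
    | (some a, some b) => .inl (a, b)
    | (some a, none) => .inr (.inl a)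
    | (none, y) => .inr (.inr y)
  invFun
    | .inl (a, b) => (some a, some b)
    | .inr (.inl a) => (some a, none)
    | .inr (.inr y) => (none, y)
  left_inv := by rintro ⟨_ | a, _ | b⟩ <;> rfl
  right_inv := by rintro (⟨a, b⟩ | a | y) <;> rfl

/-- The swap on the pairs involving the last level of either tensor factor. -/
def borderSwap (α : Type) : Equiv.Perm (α ⊕ Option α) where
  toFun
    | .inl a => .inr (some a)
    | .inr (some a) => .inl a
    | .inr none => .inr none
  invFun
    | .inl a => .inr (some a)
    | .inr (some a) => .inl a
    | .inr none => .inr none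
  left_inv := by rintro (a | _ | a) <;> rfl
  right_inv := by rintro (a | _ | a) <;> rfl

/-- `r` is the operator Schmidt rank of some unitary on `ℂ^α ⊗ ℂ^β`. -/
def IsUnitarySchmidtRank (α β : Type) [Fintype α] [Fintype β] [DecidableEq α] [DecidableEq β]
    (r : ℕ) : Prop :=
  ∃ U ∈ Matrix.unitaryGroup (α × β) ℂ, (reshuffle U).rank = r

section

variable {α α' β β' : Type} [Fintype α] [Fintype β] [DecidableEq α] [DecidableEq β]
  [Fintype α'] [Fintype β'] [DecidableEq α'] [DecidableEq β']

theorem IsUnitarySchmidtRank.congr {r : ℕ} (h : IsUnitarySchmidtRank α β r) (e : α ≃ α')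
    (f : β ≃ β') : IsUnitarySchmidtRank α' β' r := by
  obtain ⟨U, hU, rfl⟩ := h
  refine ⟨_, submatrix_equiv_mem_unitaryGroup hU (e.prodCongr f).symm, ?_⟩
  rw [← Matrix.rank_submatrix (reshuffle U) (e.prodCongr e).symm (f.prodCongr f).symm]
  rfl

theorem IsUnitarySchmidtRank.swap {r : ℕ} (h : IsUnitarySchmidtRank α β r) :
    IsUnitarySchmidtRank β α r := by
  obtain ⟨U, hU, rfl⟩ := h
  refine ⟨_, submatrix_equiv_mem_unitaryGroup hU (Equiv.prodComm β α), ?_⟩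
  rw [← Matrix.rank_transpose (reshuffle U)]
  rfl

theorem isUnitarySchmidtRank_one [Nonempty α] [Nonempty β] : IsUnitarySchmidtRank α β 1 := by
  refine ⟨1, one_mem _, ?_⟩
  have h : reshuffle (1 : Matrix (α × β) (α × β) ℂ) =
      Matrix.vecMulVec (fun p => (1 : Matrix α α ℂ) p.1 p.2)
        (fun q => (1 : Matrix β β ℂ) q.1 q.2) := by
    ext p q
    simp [reshuffle, Matrix.vecMulVec_apply, Matrix.one_apply, Prod.ext_iff, ite_and]
    split_ifs <;> rfl
  refine le_antisymm (h ▸ Matrix.rank_vecMulVec_le _ _) ?_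
  obtain ⟨a⟩ := ‹Nonempty α›
  obtain ⟨b⟩ := ‹Nonempty β›
  have h1 : (reshuffle (1 : Matrix (α × β) (α × β) ℂ)).submatrix (fun _ : Unit => (a, a))
      (fun _ : Unit => (b, b)) = 1 := by
    ext
    simp [reshuffle]
  simpa [h1] using Matrix.rank_submatrix_le (reshuffle (1 : Matrix (α × β) (α × β) ℂ))
    (fun _ : Unit => (a, a)) (fun _ : Unit => (b, b))

theorem extendRight_mem_unitaryGroup {U : Matrix (α × β) (α × β) ℂ} {W : Matrix α α ℂ}
    (hU : U ∈ Matrix.unitaryGroup (α × β) ℂ) (hW : W ∈ Matrix.unitaryGroup α ℂ) :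
    extendRight U W ∈ Matrix.unitaryGroup (α × Option β) ℂ :=
  submatrix_equiv_mem_unitaryGroup (fromBlocks_mem_unitaryGroup hU hW) _

theorem IsUnitarySchmidtRank.succ_right {r : ℕ} (h : IsUnitarySchmidtRank α β r)
    (hr : r < Fintype.card α ^ 2) : IsUnitarySchmidtRank α (Option β) (r + 1) := by
  obtain ⟨U, hU, rfl⟩ := h
  set V := Submodule.span ℂ (Set.range (reshuffle U).col) with hV
  let v : Matrix α α ℂ ≃ₗ[ℂ] (α × α → ℂ) := (LinearEquiv.curry ℂ ℂ α α).symm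
  obtain ⟨W, hW, hWV⟩ : ∃ W ∈ Matrix.unitaryGroup α ℂ, W ∉ V.comap v.toLinearMap := by
    refine exists_unitary_not_mem fun h => hr.ne ?_
    have : V = ⊤ := Submodule.comap_injective_of_surjective v.surjective (by simpa using h)
    rw [Matrix.rank_eq_finrank_span_cols, ← hV, this]
    simp [sq]
  refine ⟨_, extendRight_mem_unitaryGroup hU hW, ?_⟩
  rw [rank_reshuffle_extendRight, Matrix.rank_eq_finrank_span_cols]
  exact Submodule.finrank_sup_span_singleton hWV

theorem IsUnitarySchmidtRank.option_right_of_eq {r : ℕ} (h : IsUnitarySchmidtRank α β r)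
    (hr : r = Fintype.card α ^ 2) : IsUnitarySchmidtRank α (Option β) r := by
  obtain ⟨U, hU, rfl⟩ := h
  refine ⟨_, extendRight_mem_unitaryGroup hU (one_mem _), ?_⟩
  have hV : Submodule.span ℂ (Set.range (reshuffle U).col) = ⊤ := by
    apply Submodule.eq_top_of_finrank_eq
    rw [← Matrix.rank_eq_finrank_span_cols, hr]
    simp [sq]
  rw [rank_reshuffle_extendRight, Matrix.rank_eq_finrank_span_cols, hV, top_sup_eq]

theorem IsUnitarySchmidtRank.option_option {r : ℕ} (h : IsUnitarySchmidtRank α α r) :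
    IsUnitarySchmidtRank (Option α) (Option α) (r + (2 * Fintype.card α + 1)) := by
  obtain ⟨U, hU, rfl⟩ := h
  have hP := permMatrix_mem_unitaryGroup (borderSwap α)
  refine ⟨_, submatrix_equiv_mem_unitaryGroup (fromBlocks_mem_unitaryGroup hU hP)
    (optionProdOptionEquivSum α), ?_⟩
  have h : reshuffle ((Matrix.fromBlocks U 0 0 ((borderSwap α).permMatrix ℂ)).submatrix
      (optionProdOptionEquivSum α) (optionProdOptionEquivSum α)) =
      (Matrix.fromBlocks (reshuffle U) 0 0 ((borderSwap α).permMatrix ℂ)).submatrix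
      (optionProdOptionEquivSum α) (optionProdOptionEquivSum α) := by
    ext ⟨_ | a, _ | a'⟩ ⟨_ | b, _ | b'⟩ <;>
      simp [reshuffle, optionProdOptionEquivSum, borderSwap, Equiv.Perm.permMatrix,
        PEquiv.toMatrix_apply, eq_comm]
  rw [h, Matrix.rank_submatrix, rank_fromBlocks_zero_zero,
    Matrix.rank_of_isUnit _ (Unitary.isUnit_coe (U := ⟨_, hP⟩))]
  simp
  ring

end

/-- Five times a unitary on `ℂ^3 ⊗ ℂ^3` of operator Schmidt rank `8`. -/
def rankEightMatrix : Matrix (Fin 3 × Fin 3) (Fin 3 × Fin 3) ℤ :=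
  !![5, 0, 0, 0, 0, 0, 0, 0, 0;
     0, 5, 0, 0, 0, 0, 0, 0, 0;
     0, 0, 0, 0, 3, 0, 4, 0, 0;
     0, 0, 0, 0, 0, 0, 0, 5, 0;
     0, 0, 5, 0, 0, 0, 0, 0, 0;
     0, 0, 0, 0, 0, 5, 0, 0, 0;
     0, 0, 0, 0, -4, 0, 3, 0, 0;
     0, 0, 0, 5, 0, 0, 0, 0, 0;
     0, 0, 0, 0, 0, 0, 0, 0, 5].submatrix finProdFinEquiv finProdFinEquiv

/-- A left inverse, up to the factor `300` and on the nonzero columns, of the realignment of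
`rankEightMatrix`. -/
def rankEightLeftInverse : Matrix (Fin 3 × Fin 3) (Fin 3 × Fin 3) ℤ :=
  !![0, 0, 0, 0, -100, 0, 0, 0, 100;
     0, 0, 0, 0, 0, 60, 0, 0, 0;
     0, 0, 0, 0, 0, 0, 0, 0, 0;
     0, 0, 0, 0, 0, 48, 0, 60, 0;
     60, 0, 0, 0, 100, 0, 0, 0, -100;
     0, 0, 0, 60, 0, 0, 0, 0, 0;
     0, 0, 75, 0, 0, 0, 0, 0, 0;
     0, 100, 0, 0, 0, 0, 0, 0, 0;
     0, 0, 0, 0, 60, 0, 0, 0, 0].submatrix finProdFinEquiv finProdFinEquiv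

theorem isUnitarySchmidtRank_three_three_eight : IsUnitarySchmidtRank (Fin 3) (Fin 3) 8 := by
  let c : ℤ →+* ℂ := Int.castRingHom ℂ
  let R : Matrix (Fin 3 × Fin 3) (Fin 3 × Fin 3) ℤ :=
    Matrix.of fun p q => rankEightMatrix (p.1, q.1) (p.2, q.2)
  let d : Fin 3 × Fin 3 → ℤ := fun p => if p = (0, 2) then 0 else 1
  have hV : rankEightMatrix * rankEightMatrixᵀ = Matrix.diagonal fun _ => 25 := by decide +kernel
  have hG : rankEightLeftInverse * R = Matrix.diagonal fun p => 300 * d p := by decide +kernel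
  have hD : R * Matrix.diagonal d = R := by decide +kernel
  have hd : (Matrix.diagonal fun p => (d p : ℂ)).rank = 8 := by
    rw [Matrix.rank_diagonal, Fintype.card_subtype]
    simp only [ne_eq, Int.cast_eq_zero]
    decide
  have hV' : rankEightMatrix.map c * (rankEightMatrix.map c)ᵀ = (25 : ℂ) • 1 := by
    rw [← Matrix.transpose_map, ← Matrix.map_mul, hV]
    ext i j
    simp [c, Matrix.diagonal_apply, Matrix.one_apply, apply_ite]
  have hG' : rankEightLeftInverse.map c * R.map c =
      (300 : ℂ) • Matrix.diagonal fun p => (d p : ℂ) := by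
    rw [← Matrix.map_mul, hG]
    ext i j
    obtain rfl | h := eq_or_ne i j <;> simp [c, *]
  have hD' : R.map c * Matrix.diagonal (fun p => (d p : ℂ)) = R.map c := by
    conv_rhs => rw [← hD, Matrix.map_mul, Matrix.diagonal_map (map_zero c)]
    rfl
  have hconj : (rankEightMatrix.map c)ᴴ = (rankEightMatrix.map c)ᵀ := by
    ext i j
    simp [c]
  refine ⟨(5⁻¹ : ℂ) • rankEightMatrix.map c, ?_, ?_⟩
  · rw [Matrix.mem_unitaryGroup_iff, Matrix.star_eq_conjTranspose, Matrix.conjTranspose_smul,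
      hconj, Matrix.smul_mul, Matrix.mul_smul, hV', smul_smul, smul_smul]
    norm_num
  · change ((5⁻¹ : ℂ) • R.map c).rank = 8
    rw [Matrix.rank_smul_of_mem_nonZeroDivisors _ (by simp)]
    refine le_antisymm ?_ ?_
    · rw [← hd, ← hD']
      exact Matrix.rank_mul_le_right _ _
    · rw [← hd, ← Matrix.rank_smul_of_mem_nonZeroDivisors (c := (300 : ℂ)) _ (by simp), ← hG']
      exact Matrix.rank_mul_le_right _ _

theorem isUnitarySchmidtRank_fin_succ_right {n m r : ℕ}
    (h : ∀ s, 1 ≤ s → s ≤ n ^ 2 → (n, s) ≠ (2, 3) → IsUnitarySchmidtRank (Fin n) (Fin m) s)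
    (hm : m ≠ 0) (hr : 1 ≤ r) (hrn : r ≤ n ^ 2) :
    IsUnitarySchmidtRank (Fin n) (Fin (m + 1)) r := by
  have : NeZero n := ⟨by rintro rfl; simp at hrn; omega⟩
  have : NeZero m := ⟨hm⟩
  suffices H : IsUnitarySchmidtRank (Fin n) (Option (Fin m)) r from
    H.congr (Equiv.refl _) (finSuccEquiv m).symm
  obtain rfl | hrn := hrn.eq_or_lt
  · refine (h _ hr le_rfl fun h => ?_).option_right_of_eq (by simp)
    obtain ⟨rfl, h⟩ := Prod.ext_iff.1 h
    simp at h
  obtain rfl | hr := hr.eq_or_lt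
  · exact isUnitarySchmidtRank_one
  obtain ⟨r, rfl⟩ := Nat.exists_eq_add_of_le' hr.le
  refine (h r (by omega) (by omega) fun h => ?_).succ_right (by simp; omega)
  obtain ⟨rfl, rfl⟩ := Prod.ext_iff.1 h
  simp at hrn

theorem isUnitarySchmidtRank_fin_self {n r : ℕ} (hr : 1 ≤ r) (hrn : r ≤ n ^ 2)
    (h : (n, r) ≠ (2, 3)) : IsUnitarySchmidtRank (Fin n) (Fin n) r := by
  induction n generalizing r with
  | zero => simp at hrn; omega
  | succ n ih =>
    have e := (finSuccEquiv n).symm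
    by_cases hn : n = 0
    · subst hn
      obtain rfl : r = 1 := by omega
      exact isUnitarySchmidtRank_one
    obtain rfl | hr1 := hr.eq_or_lt
    · exact isUnitarySchmidtRank_one
    by_cases h38 : (n, r) = (2, 8)
    · obtain ⟨rfl, rfl⟩ := Prod.ext_iff.1 h38
      exact isUnitarySchmidtRank_three_three_eight
    simp only [ne_eq, Prod.mk.injEq] at h h38
    obtain hr2 | hr2 := le_or_gt r (2 * n + 1)
    · obtain ⟨r, rfl⟩ := Nat.exists_eq_add_of_le' hr
      have hrn : r ≤ n ^ 2 := by
        obtain rfl | hn : n = 1 ∨ 2 ≤ n := by omega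
        · omega
        · nlinarith
      have h2 : IsUnitarySchmidtRank (Fin n) (Fin (n + 1)) r :=
        isUnitarySchmidtRank_fin_succ_right (fun _ => ih) hn (by omega) hrn
      exact (h2.swap.succ_right (by simp; nlinarith)).congr (Equiv.refl _) e
    · have h2 := ih (r := r - (2 * n + 1)) (by omega) (by rw [add_sq] at hrn; omega)
        (by rw [ne_eq, Prod.mk.injEq]; omega)
      have h3 := h2.option_option.congr e e
      rwa [Fintype.card_fin, Nat.sub_add_cancel hr2.le] at h3

theorem isUnitarySchmidtRank_fin_of_lt {n m r : ℕ} (hnm : n < m) (hr : 1 ≤ r)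
    (hrn : r ≤ n ^ 2) : IsUnitarySchmidtRank (Fin n) (Fin m) r := by
  have hn : n ≠ 0 := by rintro rfl; simp at hrn; omega
  induction m, hnm using Nat.le_induction generalizing r with
  | base =>
    exact isUnitarySchmidtRank_fin_succ_right (n := n) (m := n)
      (fun _ => isUnitarySchmidtRank_fin_self) hn hr hrn
  | succ m hnm ih =>
    exact isUnitarySchmidtRank_fin_succ_right
      (fun _ h1 h2 _ => ih h1 h2) (by omega) hr hrn

/-- Main theorem: for `(n,m) ≠ (2,2)` and any `r ∈ {1, ..., min(n,m)²}` there
is a unitary on `ℂ^n ⊗ ℂ^m` with operator Schmidt rank `r`. -/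
theorem stmt19 (n m r : ℕ) (hnm : (n, m) ≠ (2, 2))
    (hr1 : 1 ≤ r) (hr2 : r ≤ min n m ^ 2) :
    ∃ U ∈ Matrix.unitaryGroup (Fin n × Fin m) ℂ, osr U = r := by
  change IsUnitarySchmidtRank (Fin n) (Fin m) r
  rcases lt_trichotomy n m with h | rfl | h
  · rw [min_eq_left h.le] at hr2
    exact isUnitarySchmidtRank_fin_of_lt h hr1 hr2
  · rw [min_self] at hr2
    exact isUnitarySchmidtRank_fin_self hr1 hr2
      (by simpa using fun h _ => hnm (by simp [h]))
  · rw [min_eq_right h.le] at hr2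
    exact (isUnitarySchmidtRank_fin_of_lt h hr1 hr2).swap
end
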